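/- For every v ∈ C₀^∞(ℝ^n), inf over c ∈ ℝ of ∫ |∇[(v - c) e^{-|x|²/2}]|² dx is at most ((n+2)/2) ∫ |∇v|² e^{-|x|²} dx. -/

import Mathlib

open MeasureTheory Real

local notation "ES" n => EuclideanSpace ℝ (Fin n)

lemma aux_int0 (n : ℕ) (b : ℝ) (hb : 0 < b) : Integrable (fun x : ES n => Real.exp (-b * ‖x‖ ^ 2)) := by
  have := (GaussianFourier.integrable_cexp_neg_mul_sq_norm_add (b := (b : ℂ)) (by simpa using hb) 0 (0 : ES n)).norm
  refine this.congr (Filter.Eventually.of_forall fun x => ?_)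
  simp only [Complex.norm_exp]
  congr 1
  simp [← Complex.ofReal_pow]

lemma aux_int1 (n : ℕ) : Integrable (fun x : ES n => (1 + ‖x‖ ^ 2) * Real.exp (-‖x‖ ^ 2)) := by
  refine ((aux_int0 n (1/2) (by norm_num)).const_mul 2).mono' (by fun_prop) (Filter.Eventually.of_forall fun x => ?_)
  rw [Real.norm_of_nonneg (by positivity)]
  have h : Real.exp (-‖x‖ ^ 2) = Real.exp (-(1/2) * ‖x‖ ^ 2) * Real.exp (-(1/2) * ‖x‖ ^ 2) := by
    rw [← Real.exp_add]; ring_nf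
  have h2 : (1 + ‖x‖ ^ 2) * Real.exp (-(1/2) * ‖x‖ ^ 2) ≤ 2 := by
    have : Real.exp (-(1/2) * ‖x‖ ^ 2) * Real.exp ((1/2) * ‖x‖ ^ 2) = 1 := by
      rw [← Real.exp_add]; simp
    have h3 := Real.add_one_le_exp ((1/2) * ‖x‖ ^ 2)
    have h4 := Real.exp_pos (-(1/2) * ‖x‖ ^ 2)
    nlinarith [sq_nonneg ‖x‖]
  rw [h, ← mul_assoc]
  exact mul_le_mul_of_nonneg_right h2 (Real.exp_pos _).le

lemma aux_intE {n : ℕ} {h : (ES n) → ℝ} (hc : Continuous h) (C : ℝ)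
    (hb : ∀ x, |h x| ≤ C * (1 + ‖x‖ ^ 2)) : Integrable (fun x => h x * Real.exp (-‖x‖ ^ 2)) := by
  refine ((aux_int1 n).const_mul C).mono' (by fun_prop) (Filter.Eventually.of_forall fun x => ?_)
  rw [norm_mul, Real.norm_eq_abs, Real.norm_of_nonneg (Real.exp_pos _).le, ← mul_assoc]
  exact mul_le_mul_of_nonneg_right (hb x) (Real.exp_pos _).le

lemma aux_intP0 (n : ℕ) : Integrable (fun p : (ES n) × (ES n) => ((1 + ‖p.1‖ ^ 2) * (1 + ‖p.2‖ ^ 2)) *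
      (Real.exp (-‖p.1‖ ^ 2) * Real.exp (-‖p.2‖ ^ 2))) := by
  refine ((aux_int1 n).mul_prod (aux_int1 n)).congr (Filter.Eventually.of_forall fun x => ?_)
  simp only; ring

lemma aux_intP {n : ℕ} {h : (ES n) × (ES n) → ℝ} (hc : Continuous h) (C : ℝ)
    (hb : ∀ p, |h p| ≤ C * ((1 + ‖p.1‖ ^ 2) * (1 + ‖p.2‖ ^ 2))) :
    Integrable (fun p => h p * (Real.exp (-‖p.1‖ ^ 2) * Real.exp (-‖p.2‖ ^ 2))) := by
  refine ((aux_intP0 n).const_mul C).mono' (by fun_prop) (Filter.Eventually.of_forall fun x => ?_)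
  have h0 : 0 ≤ Real.exp (-‖x.1‖ ^ 2) * Real.exp (-‖x.2‖ ^ 2) := by positivity
  rw [norm_mul, Real.norm_eq_abs, Real.norm_of_nonneg h0, ← mul_assoc C]
  exact mul_le_mul_of_nonneg_right (hb x) h0

lemma aux_rotnorm {n : ℕ} (θ : ℝ) (x y : ES n) :
    ‖cos θ • x + sin θ • y‖ ^ 2 + ‖-sin θ • x + cos θ • y‖ ^ 2 = ‖x‖ ^ 2 + ‖y‖ ^ 2 := by
  rw [norm_add_sq_real, norm_add_sq_real]
  simp only [norm_smul, inner_smul_left, inner_smul_right, mul_pow, norm_neg, Real.norm_eq_abs, sq_abs]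
  simp
  linear_combination (‖x‖^2 + ‖y‖^2) * (Real.sin_sq_add_cos_sq θ)

noncomputable def auxRot (n : ℕ) (θ : ℝ) : WithLp 2 ((ES n) × (ES n)) →ₗᵢ[ℝ] WithLp 2 ((ES n) × (ES n)) where
  toFun p := WithLp.toLp 2 (cos θ • p.fst + sin θ • p.snd, -sin θ • p.fst + cos θ • p.snd)
  map_add' p q := by
    simp [← WithLp.toLp_add]; constructor <;> module
  map_smul' c p := by
    simp [← WithLp.toLp_smul]; constructor <;> module
  norm_map' p := by
    have := aux_rotnorm θ p.fst p.snd
    rw [← sq_eq_sq₀ (norm_nonneg _) (norm_nonneg _), WithLp.prod_norm_sq_eq_of_L2,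
      WithLp.prod_norm_sq_eq_of_L2]
    simpa using this

lemma aux_rot {n : ℕ} (θ : ℝ) (F : (ES n) × (ES n) → ℝ) :
    ∫ p : (ES n) × (ES n), F (cos θ • p.1 + sin θ • p.2, -sin θ • p.1 + cos θ • p.2) = ∫ p, F p := by
  let e : WithLp 2 ((ES n) × (ES n)) ≃ₗᵢ[ℝ] WithLp 2 ((ES n) × (ES n)) :=
    (auxRot n θ).toLinearIsometryEquiv rfl
  have h1 := (WithLp.volume_preserving_symm_measurableEquiv_toLp_prod (ES n) (ES n))
  rw [← h1.integral_comp (MeasurableEquiv.measurableEmbedding _), ← h1.integral_comp (MeasurableEquiv.measurableEmbedding _)]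
  exact e.measurePreserving.integral_comp e.toHomeomorph.measurableEmbedding
    (fun q => F ((MeasurableEquiv.toLp 2 ((ES n) × (ES n))).symm q))

lemma aux_hasγ {n : ℕ} (x : ES n) :
    HasFDerivAt (fun y : ES n => Real.exp (-‖y‖ ^ 2)) ((-2 * Real.exp (-‖x‖ ^ 2)) • innerSL ℝ x) x := by
  have h := ((hasStrictFDerivAt_norm_sq x).hasFDerivAt.neg).exp
  convert! h using 1
  ext z
  simp
  ring

/-- Gaussian integration by parts in direction u. -/
lemma aux_ibp {n : ℕ} {f : (ES n) → ℝ} (u : ES n)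
    {L : (ES n) → ((ES n) →L[ℝ] ℝ)} (hL : ∀ x, HasFDerivAt f (L x) x)
    (hLc : Continuous fun x => L x u) (A B : ℝ) (hA : ∀ x, |f x| ≤ A) (hB : ∀ x, |L x u| ≤ B) :
    ∫ x, f x * inner ℝ u x * Real.exp (-‖x‖ ^ 2) = 1 / 2 * ∫ x, L x u * Real.exp (-‖x‖ ^ 2) := by
  have hfc : Continuous f := continuous_iff_continuousAt.2 fun x => (hL x).continuousAt
  have hA0 : 0 ≤ A := (abs_nonneg _).trans (hA 0)
  have hB0 : 0 ≤ B := (abs_nonneg _).trans (hB 0)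
  have i1 : Integrable (fun x => L x u * Real.exp (-‖x‖ ^ 2)) :=
    aux_intE hLc B fun x => (hB x).trans (by nlinarith [sq_nonneg ‖x‖])
  have i2 : Integrable (fun x => f x * inner ℝ u x * Real.exp (-‖x‖ ^ 2)) := by
    refine aux_intE (by fun_prop) (A * ‖u‖) fun x => ?_
    rw [abs_mul, mul_assoc]
    refine mul_le_mul (hA x) ((abs_real_inner_le_norm u x).trans ?_) (abs_nonneg _) hA0
    gcongr
    nlinarith [sq_nonneg (‖x‖ - 1)]
  have i3 : Integrable (fun x => f x * Real.exp (-‖x‖ ^ 2)) :=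
    aux_intE hfc A fun x => (hA x).trans (by nlinarith [sq_nonneg ‖x‖])
  have e : ∀ x : ES n, fderiv ℝ (fun y : ES n => Real.exp (-‖y‖ ^ 2)) x u
      = -2 * (inner ℝ u x * Real.exp (-‖x‖ ^ 2)) := by
    intro x
    rw [(aux_hasγ x).fderiv]
    simp [real_inner_comm]; ring
  have := integral_mul_fderiv_eq_neg_fderiv_mul_of_integrable (μ := (volume : Measure (ES n)))
    (f := f) (g := fun y : ES n => Real.exp (-‖y‖ ^ 2)) (v := u)
    (by simpa [(hL _).fderiv] using i1)
    (by simp only [e]; convert! i2.const_mul (-2) using 2; ring)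
    i3 (fun x _ => (hL x).differentiableAt) (fun x _ => (aux_hasγ x).differentiableAt)
  simp only [e, (hL _).fderiv] at this
  have h2 : ∫ x, f x * (-2 * (inner ℝ u x * Real.exp (-‖x‖ ^ 2))) =
      -2 * ∫ x, f x * inner ℝ u x * Real.exp (-‖x‖ ^ 2) := by
    rw [← integral_const_mul]; congr 1; ext x; ring
  rw [h2] at this
  linarith

lemma aux_step3 {n : ℕ} {v : (ES n) → ℝ} {G : (ES n) → (ES n)} (hG : ∀ x, HasFDerivAt v (innerSL ℝ (G x)) x)
    (hGc : Continuous G) (M K : ℝ) (hM : ∀ x, |v x| ≤ M) (hK : ∀ x, ‖G x‖ ≤ K) (c s : ℝ) :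
    ∫ p : (ES n) × (ES n), v (c • p.1 - s • p.2) * inner ℝ (G p.1) p.2 *
        (Real.exp (-‖p.1‖ ^ 2) * Real.exp (-‖p.2‖ ^ 2)) =
    -(s / 2) * ∫ p : (ES n) × (ES n), inner ℝ (G (c • p.1 - s • p.2)) (G p.1) *
        (Real.exp (-‖p.1‖ ^ 2) * Real.exp (-‖p.2‖ ^ 2)) := by
  have hvc : Continuous v := continuous_iff_continuousAt.2 fun x => (hG x).continuousAt
  have hM0 : 0 ≤ M := (abs_nonneg _).trans (hM 0)
  have hK0 : 0 ≤ K := (norm_nonneg _).trans (hK 0)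
  have j1 : Integrable (fun p : (ES n) × (ES n) => v (c • p.1 - s • p.2) * inner ℝ (G p.1) p.2 *
        (Real.exp (-‖p.1‖ ^ 2) * Real.exp (-‖p.2‖ ^ 2))) := by
    refine aux_intP (by fun_prop) (M * K) fun p => ?_
    rw [abs_mul, mul_assoc]
    refine mul_le_mul (hM _) ((abs_real_inner_le_norm _ _).trans ?_) (abs_nonneg _) hM0
    refine mul_le_mul (hK _) ?_ (norm_nonneg _) hK0
    nlinarith [sq_nonneg (‖p.2‖ - 1), sq_nonneg ‖p.1‖, mul_nonneg (sq_nonneg ‖p.1‖) (sq_nonneg ‖p.2‖)]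
  have j2 : Integrable (fun p : (ES n) × (ES n) => inner ℝ (G (c • p.1 - s • p.2)) (G p.1) *
        (Real.exp (-‖p.1‖ ^ 2) * Real.exp (-‖p.2‖ ^ 2))) := by
    refine aux_intP (by fun_prop) (K * K) fun p => (abs_real_inner_le_norm _ _).trans ?_
    refine (mul_le_mul (hK _) (hK _) (norm_nonneg _) hK0).trans ?_
    refine le_mul_of_one_le_right (by positivity) ?_
    nlinarith [sq_nonneg ‖p.2‖, sq_nonneg ‖p.1‖, mul_nonneg (sq_nonneg ‖p.1‖) (sq_nonneg ‖p.2‖)]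
  rw [Measure.volume_eq_prod] at j1 j2 ⊢
  rw [integral_prod _ j1, integral_prod _ j2, ← integral_const_mul]
  congr 1
  ext a
  have hd : ∀ b : ES n, HasFDerivAt (fun b : ES n => v (c • a - s • b)) (-s • innerSL ℝ (G (c • a - s • b))) b := by
    intro b
    have h1 : HasFDerivAt (fun b : ES n => c • a - s • b) (-(s • ContinuousLinearMap.id ℝ (ES n))) b :=
      ((hasFDerivAt_id b).const_smul s).const_sub (c • a)
    convert! (hG (c • a - s • b)).comp b h1 using 1
    ext z; simp
  have := aux_ibp (G a) hd
    (by simp only [smul_apply, innerSL_apply_apply]; fun_prop) M (|s| * (K * K)) (fun _ => hM _)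
    (fun x => by
      simp only [smul_apply, innerSL_apply_apply, smul_eq_mul, abs_mul, abs_neg]
      gcongr
      exact (abs_real_inner_le_norm _ _).trans (mul_le_mul (hK _) (hK _) (norm_nonneg _) hK0))
  simp only [smul_apply, innerSL_apply_apply, smul_eq_mul] at this
  calc _ = Real.exp (-‖a‖ ^ 2) * ∫ x, v (c • a - s • x) * inner ℝ (G a) x * Real.exp (-‖x‖ ^ 2) := by
        rw [← integral_const_mul]; congr 1; ext x; ring
    _ = _ := by
        rw [this, ← integral_const_mul, ← integral_const_mul, ← integral_const_mul]; congr 1; ext x; ring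

lemma aux_rotγ {n : ℕ} (θ : ℝ) (x y : ES n) :
    Real.exp (-‖cos θ • x + sin θ • y‖ ^ 2) * Real.exp (-‖-sin θ • x + cos θ • y‖ ^ 2) =
    Real.exp (-‖x‖ ^ 2) * Real.exp (-‖y‖ ^ 2) := by
  rw [← Real.exp_add, ← Real.exp_add]
  congr 1
  linarith [aux_rotnorm θ x y]

lemma aux_step4 {n : ℕ} {G : (ES n) → (ES n)}
    (hGc : Continuous G) (K : ℝ) (hK : ∀ x, ‖G x‖ ≤ K) (θ : ℝ) :
    ∫ p : (ES n) × (ES n), inner ℝ (G (cos θ • p.1 - sin θ • p.2)) (G p.1) *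
        (Real.exp (-‖p.1‖ ^ 2) * Real.exp (-‖p.2‖ ^ 2)) ≤
    (∫ x, ‖G x‖ ^ 2 * Real.exp (-‖x‖ ^ 2)) * ∫ x : ES n, Real.exp (-‖x‖ ^ 2) := by
  have hK0 : 0 ≤ K := (norm_nonneg _).trans (hK 0)
  have one_le : ∀ p : (ES n) × (ES n), 1 ≤ ((1 + ‖p.1‖ ^ 2) * (1 + ‖p.2‖ ^ 2)) := fun p => by
    nlinarith [sq_nonneg ‖p.2‖, sq_nonneg ‖p.1‖, mul_nonneg (sq_nonneg ‖p.1‖) (sq_nonneg ‖p.2‖)]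
  have j2 : Integrable (fun p : (ES n) × (ES n) => inner ℝ (G (cos θ • p.1 - sin θ • p.2)) (G p.1) *
        (Real.exp (-‖p.1‖ ^ 2) * Real.exp (-‖p.2‖ ^ 2))) := by
    refine aux_intP (by fun_prop) (K * K) fun p => (abs_real_inner_le_norm _ _).trans ?_
    refine (mul_le_mul (hK _) (hK _) (norm_nonneg _) hK0).trans ?_
    exact le_mul_of_one_le_right (by positivity) (one_le p)
  have j3 : Integrable (fun p : (ES n) × (ES n) => ‖G p.1‖ ^ 2 *
        (Real.exp (-‖p.1‖ ^ 2) * Real.exp (-‖p.2‖ ^ 2))) := by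
    refine aux_intP (by fun_prop) (K ^ 2) fun p => ?_
    rw [abs_of_nonneg (by positivity)]
    exact (pow_le_pow_left₀ (norm_nonneg _) (hK _) 2).trans (le_mul_of_one_le_right (by positivity) (one_le p))
  have j4 : Integrable (fun p : (ES n) × (ES n) => ‖G (cos θ • p.1 - sin θ • p.2)‖ ^ 2 *
        (Real.exp (-‖p.1‖ ^ 2) * Real.exp (-‖p.2‖ ^ 2))) := by
    refine aux_intP (by fun_prop) (K ^ 2) fun p => ?_
    rw [abs_of_nonneg (by positivity)]
    exact (pow_le_pow_left₀ (norm_nonneg _) (hK _) 2).trans (le_mul_of_one_le_right (by positivity) (one_le p))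
  have e3 : ∫ p : (ES n) × (ES n), ‖G p.1‖ ^ 2 * (Real.exp (-‖p.1‖ ^ 2) * Real.exp (-‖p.2‖ ^ 2)) =
      (∫ x, ‖G x‖ ^ 2 * Real.exp (-‖x‖ ^ 2)) * ∫ x : ES n, Real.exp (-‖x‖ ^ 2) := by
    rw [Measure.volume_eq_prod, ← integral_prod_mul]
    congr 1; ext p; ring
  have e4 : ∫ p : (ES n) × (ES n), ‖G (cos θ • p.1 - sin θ • p.2)‖ ^ 2 * (Real.exp (-‖p.1‖ ^ 2) * Real.exp (-‖p.2‖ ^ 2)) =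
      ∫ p : (ES n) × (ES n), ‖G p.1‖ ^ 2 * (Real.exp (-‖p.1‖ ^ 2) * Real.exp (-‖p.2‖ ^ 2)) := by
    rw [← aux_rot (-θ) (fun p => ‖G p.1‖ ^ 2 * (Real.exp (-‖p.1‖ ^ 2) * Real.exp (-‖p.2‖ ^ 2)))]
    simp only [aux_rotγ]
    congr 1; ext p; simp [sub_eq_add_neg]
  have : ∫ p : (ES n) × (ES n), inner ℝ (G (cos θ • p.1 - sin θ • p.2)) (G p.1) *
        (Real.exp (-‖p.1‖ ^ 2) * Real.exp (-‖p.2‖ ^ 2)) ≤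
      ∫ p : (ES n) × (ES n), (1 / 2 * (‖G (cos θ • p.1 - sin θ • p.2)‖ ^ 2 *
        (Real.exp (-‖p.1‖ ^ 2) * Real.exp (-‖p.2‖ ^ 2))) + 1 / 2 * (‖G p.1‖ ^ 2 *
        (Real.exp (-‖p.1‖ ^ 2) * Real.exp (-‖p.2‖ ^ 2)))) := by
    refine integral_mono j2 ((j4.const_mul _).add (j3.const_mul _)) fun p => ?_
    have h1 : inner ℝ (G (cos θ • p.1 - sin θ • p.2)) (G p.1) ≤
        1 / 2 * ‖G (cos θ • p.1 - sin θ • p.2)‖ ^ 2 + 1 / 2 * ‖G p.1‖ ^ 2 := by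
      have := real_inner_le_norm (G (cos θ • p.1 - sin θ • p.2)) (G p.1)
      nlinarith [sq_nonneg (‖G (cos θ • p.1 - sin θ • p.2)‖ - ‖G p.1‖)]
    have h2 : 0 ≤ (Real.exp (-‖p.1‖ ^ 2) * Real.exp (-‖p.2‖ ^ 2)) := by positivity
    have := mul_le_mul_of_nonneg_right h1 h2
    simp only
    linarith
  rw [integral_add (j4.const_mul _) (j3.const_mul _), integral_const_mul, integral_const_mul, e4, e3] at this
  linarith

lemma aux_deriv {n : ℕ} {v : (ES n) → ℝ} {G : (ES n) → (ES n)} (hG : ∀ x, HasFDerivAt v (innerSL ℝ (G x)) x)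
    (hGc : Continuous G) (M K : ℝ) (hM : ∀ x, |v x| ≤ M) (hK : ∀ x, ‖G x‖ ≤ K) (θ : ℝ) :
    HasDerivAt (fun t => ∫ p : (ES n) × (ES n), v p.1 * v (cos t • p.1 + sin t • p.2) *
        (Real.exp (-‖p.1‖ ^ 2) * Real.exp (-‖p.2‖ ^ 2)))
      (-(sin θ / 2) * ∫ p : (ES n) × (ES n), inner ℝ (G (cos θ • p.1 - sin θ • p.2)) (G p.1) *
        (Real.exp (-‖p.1‖ ^ 2) * Real.exp (-‖p.2‖ ^ 2))) θ := by
  have hvc : Continuous v := continuous_iff_continuousAt.2 fun x => (hG x).continuousAt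
  have hM0 : 0 ≤ M := (abs_nonneg _).trans (hM 0)
  have hK0 : 0 ≤ K := (norm_nonneg _).trans (hK 0)
  have one_le : ∀ p : (ES n) × (ES n), 1 ≤ ((1 + ‖p.1‖ ^ 2) * (1 + ‖p.2‖ ^ 2)) := fun p => by
    nlinarith [sq_nonneg ‖p.2‖, sq_nonneg ‖p.1‖, mul_nonneg (sq_nonneg ‖p.1‖) (sq_nonneg ‖p.2‖)]
  have key := (hasDerivAt_integral_of_dominated_loc_of_deriv_le
    (μ := (volume : Measure ((ES n) × (ES n)))) (s := Set.univ) (x₀ := θ)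
    (F := fun t p => v p.1 * v (cos t • p.1 + sin t • p.2) *
        (Real.exp (-‖p.1‖ ^ 2) * Real.exp (-‖p.2‖ ^ 2)))
    (F' := fun t p => v p.1 * inner ℝ (G (cos t • p.1 + sin t • p.2)) (-sin t • p.1 + cos t • p.2) *
        (Real.exp (-‖p.1‖ ^ 2) * Real.exp (-‖p.2‖ ^ 2)))
    (bound := fun p => (M * (K * 2)) * (((1 + ‖p.1‖ ^ 2) * (1 + ‖p.2‖ ^ 2)) *
      (Real.exp (-‖p.1‖ ^ 2) * Real.exp (-‖p.2‖ ^ 2))))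
    Filter.univ_mem
    (Filter.Eventually.of_forall fun t => Continuous.aestronglyMeasurable (by fun_prop))
    ?_ (Continuous.aestronglyMeasurable (by fun_prop)) ?_ ((aux_intP0 n).const_mul _) ?_).2
  · rw [← aux_step3 hG hGc M K hM hK]
    convert! key using 1
    rw [← aux_rot θ]
    simp only [aux_rotγ]
    congr 1; ext p
    congr 3
    have := Real.sin_sq_add_cos_sq θ
    have h : p.1 = (cos θ ^ 2 + sin θ ^ 2) • p.1 := by rw [add_comm, this, one_smul]
    congr 1
    conv_rhs => rw [h]
    module
  · refine aux_intP (by fun_prop) (M * M) fun p => ?_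
    rw [abs_mul]
    exact (mul_le_mul (hM _) (hM _) (abs_nonneg _) hM0).trans (le_mul_of_one_le_right (by positivity) (one_le p))
  · refine Filter.Eventually.of_forall fun p t _ => ?_
    have h0 : 0 ≤ Real.exp (-‖p.1‖ ^ 2) * Real.exp (-‖p.2‖ ^ 2) := by positivity
    rw [norm_mul, Real.norm_of_nonneg h0, ← mul_assoc (M * (K * 2))]
    refine mul_le_mul_of_nonneg_right ?_ h0
    rw [norm_mul, mul_assoc]
    refine mul_le_mul (hM _) ((abs_real_inner_le_norm _ _).trans ?_) (norm_nonneg _) hM0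
    rw [mul_assoc]
    refine mul_le_mul (hK _) ?_ (norm_nonneg _) hK0
    have h1 : ‖-sin t • p.1 + cos t • p.2‖ ≤ ‖p.1‖ + ‖p.2‖ := by
      refine (norm_add_le _ _).trans (add_le_add ?_ ?_)
      · rw [norm_smul, norm_neg]
        exact mul_le_of_le_one_left (norm_nonneg _) (Real.abs_sin_le_one t)
      · rw [norm_smul]
        exact mul_le_of_le_one_left (norm_nonneg _) (Real.abs_cos_le_one t)
    nlinarith [sq_nonneg (‖p.2‖ - 1), sq_nonneg (‖p.1‖ - 1), sq_nonneg ‖p.2‖, sq_nonneg ‖p.1‖, mul_nonneg (sq_nonneg ‖p.1‖) (sq_nonneg ‖p.2‖)]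
  · refine Filter.Eventually.of_forall fun p t _ => ?_
    refine HasDerivAt.mul_const ?_ _
    refine HasDerivAt.const_mul _ ?_
    have h1 : HasDerivAt (fun t => cos t • p.1 + sin t • p.2) (-sin t • p.1 + cos t • p.2) t :=
      ((Real.hasDerivAt_cos t).smul_const p.1).add ((Real.hasDerivAt_sin t).smul_const p.2)
    exact (hG (cos t • p.1 + sin t • p.2)).comp_hasDerivAt t h1

lemma aux_poincare {n : ℕ} {v : (ES n) → ℝ} {G : (ES n) → (ES n)} (hG : ∀ x, HasFDerivAt v (innerSL ℝ (G x)) x)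
    (hGc : Continuous G) (M K : ℝ) (hM : ∀ x, |v x| ≤ M) (hK : ∀ x, ‖G x‖ ≤ K) :
    (∫ x, v x ^ 2 * Real.exp (-‖x‖ ^ 2)) * (∫ x : ES n, Real.exp (-‖x‖ ^ 2))
      - (∫ x, v x * Real.exp (-‖x‖ ^ 2)) ^ 2 ≤
    1 / 2 * ((∫ x, ‖G x‖ ^ 2 * Real.exp (-‖x‖ ^ 2)) * ∫ x : ES n, Real.exp (-‖x‖ ^ 2)) := by
  set DZ := (∫ x, ‖G x‖ ^ 2 * Real.exp (-‖x‖ ^ 2)) * ∫ x : ES n, Real.exp (-‖x‖ ^ 2) with hDZ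
  set φ : ℝ → ℝ := fun t => ∫ p : (ES n) × (ES n), v p.1 * v (cos t • p.1 + sin t • p.2) *
        (Real.exp (-‖p.1‖ ^ 2) * Real.exp (-‖p.2‖ ^ 2)) with hφ
  have e0 : φ 0 = (∫ x, v x ^ 2 * Real.exp (-‖x‖ ^ 2)) * (∫ x : ES n, Real.exp (-‖x‖ ^ 2)) := by
    rw [← integral_prod_mul, hφ, ← Measure.volume_eq_prod]
    simp only [cos_zero, sin_zero, one_smul, zero_smul, add_zero]
    congr 1; ext p; ring
  have e1 : φ (π / 2) = (∫ x, v x * Real.exp (-‖x‖ ^ 2)) ^ 2 := by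
    rw [sq, ← integral_prod_mul, hφ, ← Measure.volume_eq_prod]
    simp only [cos_pi_div_two, sin_pi_div_two, one_smul, zero_smul, zero_add]
    congr 1; ext p; ring
  have hd : ∀ t, HasDerivAt (fun t => φ t - 1 / 2 * DZ * cos t) _ t := fun t =>
    (aux_deriv hG hGc M K hM hK t).sub ((Real.hasDerivAt_cos t).const_mul (1 / 2 * DZ))
  have hmono : MonotoneOn (fun t => φ t - 1 / 2 * DZ * cos t) (Set.Icc 0 (π / 2)) := by
    refine monotoneOn_of_deriv_nonneg (convex_Icc _ _)
      (fun t _ => (hd t).continuousAt.continuousWithinAt)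
      (fun t _ => (hd t).differentiableAt.differentiableWithinAt) fun t ht => ?_
    rw [interior_Icc] at ht
    rw [(hd t).deriv]
    have h1 := aux_step4 hGc K hK t
    have h2 : 0 ≤ sin t := sin_nonneg_of_nonneg_of_le_pi ht.1.le (by linarith [ht.2, pi_pos])
    rw [← hDZ] at h1
    nlinarith [mul_nonneg h2 (sub_nonneg.2 h1)]
  have := hmono (a := 0) (b := π / 2) ⟨le_rfl, by positivity⟩ ⟨by positivity, le_rfl⟩ (by positivity)
  simp only [cos_zero, cos_pi_div_two, e0, e1] at this
  linarith

/-- the virial identity -/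
lemma aux_virial {n : ℕ} {w : (ES n) → ℝ} {G : (ES n) → (ES n)} (hG : ∀ x, HasFDerivAt w (innerSL ℝ (G x)) x)
    (hGc : Continuous G) (M K : ℝ) (hM : ∀ x, |w x| ≤ M) (hK : ∀ x, ‖G x‖ ≤ K) :
    ∫ x, 2 * w x * inner ℝ (G x) x * Real.exp (-‖x‖ ^ 2) =
     2 * (∫ x, w x ^ 2 * ‖x‖ ^ 2 * Real.exp (-‖x‖ ^ 2)) - n * ∫ x, w x ^ 2 * Real.exp (-‖x‖ ^ 2) := by
  have hwc : Continuous w := continuous_iff_continuousAt.2 fun x => (hG x).continuousAt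
  have hM0 : 0 ≤ M := (abs_nonneg _).trans (hM 0)
  have hK0 : 0 ≤ K := (norm_nonneg _).trans (hK 0)
  have hM2 : ∀ x, w x ^ 2 ≤ M ^ 2 := fun x => by
    rw [← sq_abs]; exact pow_le_pow_left₀ (abs_nonneg _) (hM x) 2
  have hx : ∀ (x : ES n) i, |x i| ≤ ‖x‖ := fun x i => PiLp.norm_apply_le x i
  have i1 : ∀ i, Integrable fun x : ES n => 2 * w x * G x i * x i * Real.exp (-‖x‖ ^ 2) := fun i => by
    refine aux_intE (by fun_prop) (2 * M * K) fun x => ?_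
    rw [abs_mul, abs_mul, abs_mul, abs_two]
    have := (hx (G x) i).trans (hK x)
    have h2 : |x i| ≤ 1 + ‖x‖ ^ 2 := (hx x i).trans (by nlinarith [sq_nonneg (‖x‖ - 1)])
    have := hM x
    gcongr
  have i2 : ∀ i, Integrable fun x : ES n => w x ^ 2 * x i ^ 2 * Real.exp (-‖x‖ ^ 2) := fun i => by
    refine aux_intE (by fun_prop) (M ^ 2) fun x => ?_
    rw [abs_of_nonneg (by positivity), ← sq_abs (x i)]
    have h2 : |x i| ^ 2 ≤ 1 + ‖x‖ ^ 2 := (pow_le_pow_left₀ (abs_nonneg _) (hx x i) 2).trans (by linarith)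
    have := hM2 x
    gcongr
  have i3 : Integrable fun x : ES n => w x ^ 2 * Real.exp (-‖x‖ ^ 2) := by
    refine aux_intE (by fun_prop) (M ^ 2) fun x => ?_
    rw [abs_of_nonneg (by positivity)]
    exact (hM2 x).trans (le_mul_of_one_le_right (by positivity) (by nlinarith [sq_nonneg ‖x‖]))
  have i4 : ∀ i, Integrable fun x : ES n => w x ^ 2 * (x i * Real.exp (-‖x‖ ^ 2)) := fun i => by
    simp only [← mul_assoc]
    refine aux_intE (by fun_prop) (M ^ 2) fun x => ?_
    rw [abs_mul, abs_of_nonneg (a := w x ^ 2) (by positivity)]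
    have h2 : |x i| ≤ 1 + ‖x‖ ^ 2 := (hx x i).trans (by nlinarith [sq_nonneg (‖x‖ - 1)])
    have := hM2 x
    gcongr
  have hf : ∀ x, HasFDerivAt (fun y => w y ^ 2) ((2 * w x) • innerSL ℝ (G x)) x := fun x => by
    have := (hG x).pow 2
    convert! this using 1
    ext z; simp
  have hg : ∀ i x, HasFDerivAt (fun y : ES n => y i * Real.exp (-‖y‖ ^ 2))
      (x i • ((-2 * Real.exp (-‖x‖ ^ 2)) • innerSL ℝ x) +
        Real.exp (-‖x‖ ^ 2) • (EuclideanSpace.proj i : (ES n) →L[ℝ] ℝ)) x := fun i x =>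
    (EuclideanSpace.proj i : (ES n) →L[ℝ] ℝ).hasFDerivAt.mul (aux_hasγ x)
  have key : ∀ i, ∫ x : ES n, 2 * w x * G x i * x i * Real.exp (-‖x‖ ^ 2) =
      2 * (∫ x : ES n, w x ^ 2 * x i ^ 2 * Real.exp (-‖x‖ ^ 2)) - ∫ x, w x ^ 2 * Real.exp (-‖x‖ ^ 2) := by
    intro i
    have ef : ∀ x, fderiv ℝ (fun y => w y ^ 2) x (EuclideanSpace.single i 1) * (x i * Real.exp (-‖x‖ ^ 2)) =
        2 * w x * G x i * x i * Real.exp (-‖x‖ ^ 2) := fun x => by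
      rw [(hf x).fderiv]; simp [EuclideanSpace.inner_single_right]; ring
    have eg : ∀ x, w x ^ 2 * fderiv ℝ (fun y : ES n => y i * Real.exp (-‖y‖ ^ 2)) x (EuclideanSpace.single i 1) =
        w x ^ 2 * Real.exp (-‖x‖ ^ 2) - 2 * (w x ^ 2 * x i ^ 2 * Real.exp (-‖x‖ ^ 2)) := fun x => by
      rw [(hg i x).fderiv]; simp [EuclideanSpace.inner_single_right]; ring
    have := integral_mul_fderiv_eq_neg_fderiv_mul_of_integrable (μ := (volume : Measure (ES n)))
      (f := fun y => w y ^ 2) (g := fun y : ES n => y i * Real.exp (-‖y‖ ^ 2)) (v := EuclideanSpace.single i 1)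
      (by simp only [ef]; exact i1 i) (by simp only [eg]; exact i3.sub ((i2 i).const_mul 2)) (i4 i)
      (fun x _ => (hf x).differentiableAt) (fun x _ => (hg i x).differentiableAt)
    simp only [ef, eg] at this
    rw [integral_sub i3 ((i2 i).const_mul 2), integral_const_mul] at this
    linarith
  have s1 : ∀ x : ES n, 2 * w x * inner ℝ (G x) x * Real.exp (-‖x‖ ^ 2) =
      ∑ i, 2 * w x * G x i * x i * Real.exp (-‖x‖ ^ 2) := fun x => by
    rw [PiLp.inner_apply, Finset.mul_sum, Finset.sum_mul]
    refine Finset.sum_congr rfl fun i _ => ?_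
    simp; ring
  have s2 : ∀ x : ES n, w x ^ 2 * ‖x‖ ^ 2 * Real.exp (-‖x‖ ^ 2) =
      ∑ i, w x ^ 2 * x i ^ 2 * Real.exp (-‖x‖ ^ 2) := fun x => by
    conv_lhs => rw [EuclideanSpace.real_norm_sq_eq, Finset.mul_sum]
    rw [Finset.sum_mul, EuclideanSpace.real_norm_sq_eq]
  simp only [s1, s2]
  rw [integral_finsetSum _ fun i _ => i1 i, integral_finsetSum _ fun i _ => i2 i]
  simp [key, Finset.sum_sub_distrib, Finset.mul_sum]

theorem stmt14 (n : ℕ) (v : EuclideanSpace ℝ (Fin n) → ℝ)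
    (hv : ContDiff ℝ (⊤ : ℕ∞) v) (hsupp : HasCompactSupport v) :
    sInf {I : ℝ | ∃ c : ℝ,
        I = ∫ x, ‖gradient (fun y => (v y - c) * Real.exp (-‖y‖ ^ 2 / 2)) x‖ ^ 2}
      ≤ (((n : ℝ) + 2) / 2) * ∫ x, ‖gradient v x‖ ^ 2 * Real.exp (-‖x‖ ^ 2) := by
  set G := gradient v with hGdef
  have hdiff : Differentiable ℝ v := hv.differentiable (by simp)
  have hG0 : ∀ x, HasFDerivAt v (innerSL ℝ (G x)) x := fun x =>
    (hdiff x).hasGradientAt.hasFDerivAt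
  have hGf : G = fun x => (InnerProductSpace.toDual ℝ (ES n)).symm (fderiv ℝ v x) := rfl
  have hGc : Continuous G := by
    rw [hGf]
    exact (LinearIsometryEquiv.continuous _).comp (hv.continuous_fderiv (by simp))
  have hGs : HasCompactSupport G := by
    rw [hGf]
    exact (hsupp.fderiv ℝ).comp_left (by simp)
  obtain ⟨K, hK⟩ := hGs.exists_bound_of_continuous hGc
  obtain ⟨M0, hM0⟩ := hsupp.exists_bound_of_continuous hdiff.continuous
  set Z := ∫ x : ES n, Real.exp (-‖x‖ ^ 2) with hZ
  have iγ : Integrable fun x : ES n => Real.exp (-‖x‖ ^ 2) := by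
    simpa using aux_int0 n 1 one_pos
  have hZpos : 0 < Z := integral_exp_pos iγ
  set c := (∫ x, v x * Real.exp (-‖x‖ ^ 2)) / Z with hc
  set w : (ES n) → ℝ := fun x => v x - c with hw
  have hG : ∀ x, HasFDerivAt w (innerSL ℝ (G x)) x := fun x => (hG0 x).sub_const c
  have hwc : Continuous w := by have := hdiff.continuous; fun_prop
  set M := M0 + |c| with hM'
  have hM : ∀ x, |w x| ≤ M := fun x => (abs_sub _ _).trans (add_le_add_left (hM0 x) _)
  have hMn : 0 ≤ M := (abs_nonneg _).trans (hM 0)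
  have hKn : 0 ≤ K := (norm_nonneg _).trans (hK 0)
  have hM2 : ∀ x, w x ^ 2 ≤ M ^ 2 := fun x => by
    rw [← sq_abs]; exact pow_le_pow_left₀ (abs_nonneg _) (hM x) 2
  have hmean : ∫ x, w x * Real.exp (-‖x‖ ^ 2) = 0 := by
    have : Integrable fun x => v x * Real.exp (-‖x‖ ^ 2) :=
      aux_intE hdiff.continuous M0 fun x => (hM0 x).trans
        (le_mul_of_one_le_right ((norm_nonneg _).trans (hM0 0)) (by nlinarith [sq_nonneg ‖x‖]))
    simp only [hw, sub_mul]
    rw [integral_sub this (iγ.const_mul c), integral_const_mul, hc]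
    field_simp
    simp [hZ]
  have hP := aux_poincare hG hGc M K hM hK
  rw [hmean, ← hZ] at hP
  have hP' : (∫ x, w x ^ 2 * Real.exp (-‖x‖ ^ 2)) ≤ 1 / 2 * ∫ x, ‖G x‖ ^ 2 * Real.exp (-‖x‖ ^ 2) := by
    refine le_of_mul_le_mul_right ?_ hZpos
    linarith
  have hV := aux_virial hG hGc M K hM hK
  have hgrad : ∀ x, gradient (fun y => (v y - c) * Real.exp (-‖y‖ ^ 2 / 2)) x =
      Real.exp (-‖x‖ ^ 2 / 2) • (G x - w x • x) := fun x => by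
    refine HasGradientAt.gradient ?_
    rw [hasGradientAt_iff_hasFDerivAt]
    have h1 : HasFDerivAt (fun y : ES n => Real.exp (-‖y‖ ^ 2 / 2)) ((-Real.exp (-‖x‖ ^ 2 / 2)) • innerSL ℝ x) x := by
      have h := (((hasStrictFDerivAt_norm_sq x).hasFDerivAt.neg).mul_const (1 / 2)).exp
      simp only [← div_eq_mul_one_div] at h
      convert! h using 1
      ext z
      simp
    convert! (hG x).mul h1 using 1
    ext z
    simp [inner_sub_left, inner_smul_left]
    ring
  have hns : ∀ x, ‖gradient (fun y => (v y - c) * Real.exp (-‖y‖ ^ 2 / 2)) x‖ ^ 2 =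
      ‖G x‖ ^ 2 * Real.exp (-‖x‖ ^ 2) - 2 * w x * inner ℝ (G x) x * Real.exp (-‖x‖ ^ 2) +
      w x ^ 2 * ‖x‖ ^ 2 * Real.exp (-‖x‖ ^ 2) := fun x => by
    have h1 : Real.exp (-‖x‖ ^ 2) = Real.exp (-‖x‖ ^ 2 / 2) ^ 2 := by
      rw [← Real.exp_nat_mul]; congr 1; push_cast; ring
    rw [hgrad, norm_smul, mul_pow, Real.norm_of_nonneg (Real.exp_pos _).le, ← h1, norm_sub_sq_real,
      inner_smul_right, norm_smul, mul_pow, Real.norm_eq_abs, sq_abs]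
    ring
  have k1 : Integrable fun x => ‖G x‖ ^ 2 * Real.exp (-‖x‖ ^ 2) := by
    refine aux_intE (by fun_prop) (K ^ 2) fun x => ?_
    rw [abs_of_nonneg (by positivity)]
    exact (pow_le_pow_left₀ (norm_nonneg _) (hK _) 2).trans
      (le_mul_of_one_le_right (by positivity) (by nlinarith [sq_nonneg ‖x‖]))
  have k2 : Integrable fun x => 2 * w x * inner ℝ (G x) x * Real.exp (-‖x‖ ^ 2) := by
    refine aux_intE (by fun_prop) (2 * M * K) fun x => ?_
    rw [abs_mul, abs_mul, abs_two, mul_assoc (2 * M)]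
    have h2 : ‖x‖ ≤ 1 + ‖x‖ ^ 2 := by nlinarith [sq_nonneg (‖x‖ - 1)]
    have h3 := (abs_real_inner_le_norm (G x) x).trans (mul_le_mul (hK x) h2 (norm_nonneg _) hKn)
    have := hM x
    gcongr
  have k3 : Integrable fun x => w x ^ 2 * ‖x‖ ^ 2 * Real.exp (-‖x‖ ^ 2) := by
    refine aux_intE (by fun_prop) (M ^ 2) fun x => ?_
    rw [abs_of_nonneg (by positivity)]
    have := hM2 x
    gcongr
    linarith
  have k3n : 0 ≤ ∫ x, w x ^ 2 * ‖x‖ ^ 2 * Real.exp (-‖x‖ ^ 2) := integral_nonneg fun x => by positivity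
  refine le_trans (csInf_le (a := ∫ x, ‖gradient (fun y => (v y - c) * Real.exp (-‖y‖ ^ 2 / 2)) x‖ ^ 2) ⟨0, ?_⟩ ⟨c, rfl⟩) ?_
  · rintro _ ⟨c, rfl⟩
    exact integral_nonneg fun x => by positivity
  · simp only [hns]
    have k12 : Integrable fun x => ‖G x‖ ^ 2 * Real.exp (-‖x‖ ^ 2) - 2 * w x * inner ℝ (G x) x * Real.exp (-‖x‖ ^ 2) := k1.sub k2
    rw [integral_add k12 k3, integral_sub k1 k2, hV]
    have := mul_le_mul_of_nonneg_left hP' (Nat.cast_nonneg (α := ℝ) n)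
    linarith
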